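/- Inversion theorem for the fermionic Fourier transform: F^+_{0|2n} ∘ F^−_{0|2n} = id_{Λ_{2n}} and F^−_{0|2n} ∘ F^+_{0|2n} = id_{Λ_{2n}} (identifying the Grassmann algebra in the y` variables with Λ_{2n}); consequently F^±_{0|2n} is a linear isomorphism of Λ_{2n}. -/

import Mathlib

open scoped BigOperators
open Finset MeasureTheory

noncomputable section

/-- The Grassmann algebra on `N` anticommuting generators with coefficients in a
commutative ring `R`, represented by its coefficients with respect to the basis of
increasingly-ordered monomials, indexed by subsets of the generators. -/
abbrev Gr (R : Type) (N : ℕ) : Type := Finset (Fin N) → R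

namespace Gr

variable {R : Type} [CommRing R] {N : ℕ}

/-- The sign produced when reordering the concatenation of the ordered monomials indexed
by `A` and `B` into the ordered monomial indexed by `A ∪ B`. -/
def msign (A B : Finset (Fin N)) : R :=
  (-1 : R) ^ (((A ×ˢ B).filter fun p => p.2 < p.1).card)

/-- Multiplication of the Grassmann algebra. -/
def mul (f g : Gr R N) : Gr R N :=
  fun s => ∑ A ∈ s.powerset, msign A (s \ A) * f A * g (s \ A)

/-- The unit of the Grassmann algebra. -/
def one : Gr R N := fun s => if s = (∅ : Finset (Fin N)) then 1 else 0

/-- The `j`-th generator of the Grassmann algebra. -/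
def gen (j : Fin N) : Gr R N := fun s => if s = {j} then 1 else 0

/-- Powers in the Grassmann algebra. -/
def pow (f : Gr R N) : ℕ → Gr R N
  | 0 => one
  | k + 1 => mul (pow f k) f

/-- The left partial derivative `∂_j`, i.e. the odd derivation with `∂_j(x_k) = δ_{jk}`. -/
def pderiv (j : Fin N) (f : Gr R N) : Gr R N :=
  fun s => if j ∈ s then 0
    else (-1 : R) ^ ((s.filter fun i => i < j).card) * f (insert j s)

/-- The exponential of a Grassmann algebra element with nilpotent (zero-constant-term)
argument: the series terminates, and all terms beyond degree `N` vanish. -/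
def gexp (f : Gr ℂ N) : Gr ℂ N :=
  ∑ k ∈ Finset.range (N + 1), ((k.factorial : ℂ))⁻¹ • pow f k

/-- Iterated left partial derivatives: the first element of the list acts first. -/
def derivList (l : List (Fin N)) (f : Gr R N) : Gr R N :=
  l.foldl (fun g j => pderiv j g) f

/-- Complex conjugation of the coefficients. -/
def gconj (f : Gr ℂ N) : Gr ℂ N := fun s => (starRingEnd ℂ) (f s)

end Gr

/-- The Lean index of the paper's generator `x`_{2j-1}` (j = 1,…,n). -/
def lo (n : ℕ) (j : Fin n) : Fin (2 * n) := ⟨2 * (j : ℕ), by have := j.isLt; omega⟩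

/-- The Lean index of the paper's generator `x`_{2j}` (j = 1,…,n). -/
def hi (n : ℕ) (j : Fin n) : Fin (2 * n) := ⟨2 * (j : ℕ) + 1, by have := j.isLt; omega⟩

/-- `x`² = Σ_{j=1}^n x`_{2j-1} x`_{2j}`. -/
def xsq (n : ℕ) : Gr ℂ (2 * n) := ∑ j : Fin n, Gr.mul (Gr.gen (lo n j)) (Gr.gen (hi n j))

/-- The fermionic Laplace operator `Δ_f = 4 Σ_{j=1}^n ∂_{x`_{2j-1}} ∂_{x`_{2j}}`. -/
def lapF (n : ℕ) (f : Gr ℂ (2 * n)) : Gr ℂ (2 * n) :=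
  (4 : ℂ) • ∑ j : Fin n, Gr.pderiv (lo n j) (Gr.pderiv (hi n j) f)

/-- The Berezin integral `∫_B = π^{-n} ∂_{x`_{2n}} ⋯ ∂_{x`_1}`. -/
def berezin (n : ℕ) (f : Gr ℂ (2 * n)) : ℂ :=
  ((Real.pi : ℂ) ^ n)⁻¹ * Gr.derivList (List.finRange (2 * n)) f ∅

/-- The fermionic Gaussian `exp(x`²/2) = Σ_{j=0}^n (x`²)^j/(2^j j!)`. -/
def fermGauss (n : ℕ) : Gr ℂ (2 * n) :=
  ∑ j ∈ Finset.range (n + 1), (((2 : ℂ) ^ j * j.factorial)⁻¹) • Gr.pow (xsq n) j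

/-- Embedding of the `x` generators into the Grassmann algebra on the `4n` generators
`x`_1, …, x`_{2n}, y`_1, …, y`_{2n}` (the `x` generators come first). -/
def xi (n : ℕ) (t : Fin (2 * n)) : Fin (2 * n + 2 * n) := Fin.castAdd (2 * n) t

/-- Embedding of the `y` generators into the Grassmann algebra on the `4n` generators. -/
def yi (n : ℕ) (t : Fin (2 * n)) : Fin (2 * n + 2 * n) := Fin.natAdd (2 * n) t

/-- The algebra embedding `Λ_{2n} → Λ_{4n}` sending the generators to the `x` generators. -/
def embX (n : ℕ) (f : Gr ℂ (2 * n)) : Gr ℂ (2 * n + 2 * n) :=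
  fun s => ∑ A : Finset (Fin (2 * n)), if s = A.image (xi n) then f A else 0

/-- The Berezin integral with respect to the `x` variables,
`π^{-n} ∂_{x`_{2n}} ⋯ ∂_{x`_1}`, inside the mixed algebra `Λ_{4n}`. -/
def berezinX (n : ℕ) (F : Gr ℂ (2 * n + 2 * n)) : Gr ℂ (2 * n + 2 * n) :=
  ((Real.pi : ℂ) ^ n)⁻¹ • Gr.derivList ((List.finRange (2 * n)).map (xi n)) F

/-- The fermionic Fourier kernel
`K^σ(x, y) = exp(-σ (i/2) Σ_{j=1}^n (x`_{2j-1} y`_{2j} - x`_{2j} y`_{2j-1}))`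
(for the plus sign `σ = 1`, for the minus sign `σ = -1`). -/
def fermK (n : ℕ) (σ : ℂ) : Gr ℂ (2 * n + 2 * n) :=
  Gr.gexp ((-σ * (Complex.I / 2)) • ∑ j : Fin n,
    (Gr.mul (Gr.gen (xi n (lo n j))) (Gr.gen (yi n (hi n j))) -
     Gr.mul (Gr.gen (xi n (hi n j))) (Gr.gen (yi n (lo n j)))))

/-- The fermionic Fourier transform
`F^σ_{0|2n}(g)(y) = (2π)^n ∫_{B,x} K^σ(x,y) g(x)`, an element of the Grassmann algebra
in the `y` variables, identified with `Λ_{2n}`. -/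
def fermFT (n : ℕ) (σ : ℂ) (g : Gr ℂ (2 * n)) : Gr ℂ (2 * n) :=
  fun s => (((2 * Real.pi : ℝ) : ℂ) ^ n) *
    berezinX n (Gr.mul (fermK n σ) (embX n g)) (s.image (yi n))


end

namespace Gr

variable {N : ℕ}

theorem msign_eq_prod (A B : Finset (Fin N)) :
    (msign A B : ℂ) = ∏ a ∈ A, ∏ b ∈ B, if b < a then -1 else 1 := by
  rw [← Finset.prod_product' A B fun a b => if b < a then (-1 : ℂ) else 1, ← Finset.prod_filter,
    Finset.prod_const]
  rfl

theorem mul_single (f : Gr ℂ N) (T s : Finset (Fin N)) :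
    mul f (Pi.single T 1) s = if T ⊆ s then msign (s \ T) T * f (s \ T) else 0 := by
  unfold mul
  split_ifs with h
  · rw [Finset.sum_eq_single (s \ T)]
    · simp [Finset.sdiff_sdiff_eq_self h]
    · intro A hA hne
      rw [Pi.single_eq_of_ne, mul_zero]
      rintro rfl
      exact hne (Finset.sdiff_sdiff_eq_self (Finset.mem_powerset.1 hA)).symm
    · intro h'
      exact absurd (Finset.mem_powerset.2 Finset.sdiff_subset) h'
  · refine Finset.sum_eq_zero fun A _ => ?_
    rw [Pi.single_eq_of_ne, mul_zero]
    rintro rfl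
    exact h Finset.sdiff_subset

theorem mul_smul_right (f g : Gr ℂ N) (c : ℂ) : mul f (c • g) = c • mul f g := by
  funext s
  simp only [mul, Pi.smul_apply, smul_eq_mul, Finset.mul_sum]
  exact Finset.sum_congr rfl fun _ _ => by ring

theorem mul_sum_right {ι : Type*} (t : Finset ι) (f : Gr ℂ N) (g : ι → Gr ℂ N) :
    mul f (∑ i ∈ t, g i) = ∑ i ∈ t, mul f (g i) := by
  funext s
  simp only [mul, Finset.sum_apply, Finset.mul_sum]
  exact Finset.sum_comm

theorem gen_eq_single (j : Fin N) : (gen j : Gr ℂ N) = Pi.single {j} 1 := by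
  funext s
  simp [gen, Pi.single_apply]

theorem gen_mul_gen {a b : Fin N} (h : a < b) :
    mul (gen a : Gr ℂ N) (gen b) = Pi.single {a, b} 1 := by
  funext s
  rw [gen_eq_single b, mul_single, Pi.single_apply]
  by_cases hs : s = {a, b}
  · have hd : s \ {b} = {a} := by
      subst hs
      ext x
      simp only [Finset.mem_sdiff, Finset.mem_insert, Finset.mem_singleton]
      constructor
      · rintro ⟨h1 | h1, h2⟩
        · exact h1
        · exact absurd h1 h2
      · rintro rfl
        exact ⟨Or.inl rfl, h.ne⟩
    have hb : {b} ⊆ s := by simp [hs]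
    rw [if_pos hb, if_pos hs, hd, msign_eq_prod]
    simp [gen, h.not_gt]
  · rw [if_neg hs]
    split_ifs with hb
    · have hd : s \ {b} ≠ {a} := by
        intro hd
        apply hs
        rw [← Finset.sdiff_union_of_subset hb, hd]
        rfl
      simp [gen, hd]
    · rfl

theorem derivList_apply (l : List (Fin N)) (hl : l.Pairwise (· < ·)) (f : Gr ℂ N)
    (s : Finset (Fin N)) (hs : ∀ i ∈ l, ∀ j ∈ s, i < j) :
    derivList l f s = f (l.toFinset ∪ s) := by
  induction l generalizing f with
  | nil => simp [derivList]
  | cons a l ih =>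
    rw [List.pairwise_cons] at hl
    have hlt : ∀ j ∈ l.toFinset ∪ s, a < j := by
      intro j hj
      rcases Finset.mem_union.1 hj with hj | hj
      · exact hl.1 j (List.mem_toFinset.1 hj)
      · exact hs a (by simp) j hj
    have ha : a ∉ l.toFinset ∪ s := fun h => lt_irrefl a (hlt a h)
    have hf : (l.toFinset ∪ s).filter (fun i => i < a) = ∅ :=
      Finset.filter_eq_empty_iff.2 fun j hj => (hlt j hj).not_gt
    change derivList l (pderiv a f) s = _
    rw [ih hl.2 _ fun i hi => hs i (List.mem_cons_of_mem _ hi), pderiv, if_neg ha, hf]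
    simp [Finset.insert_union]

end Gr

theorem prod_ite_eq_one_neg_one {ι : Type*} [DecidableEq ι] (T : Finset ι) (r : ι) :
    (∏ q ∈ T, if q = r then (1 : ℂ) else -1) = (-1) ^ T.card * if r ∈ T then -1 else 1 := by
  have h : ∀ q, (if q = r then (1 : ℂ) else -1) = -1 * if q = r then -1 else 1 := by
    intro q
    split_ifs <;> simp
  simp only [h, Finset.prod_mul_distrib, Finset.prod_const, Finset.prod_ite_eq']

section Swap

variable {n : ℕ}

/-- The involution of the generators exchanging `x`_{2j-1}` and `x`_{2j}`. -/
def pairSwap (n : ℕ) (p : Fin (2 * n)) : Fin (2 * n) :=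
  ⟨if (p : ℕ) % 2 = 0 then p + 1 else p - 1, by have := p.isLt; split_ifs <;> omega⟩

theorem pairSwap_val (p : Fin (2 * n)) :
    (pairSwap n p : ℕ) = if (p : ℕ) % 2 = 0 then (p : ℕ) + 1 else p - 1 := rfl

@[simp] theorem pairSwap_pairSwap (p : Fin (2 * n)) : pairSwap n (pairSwap n p) = p := by
  apply Fin.ext
  simp only [pairSwap_val]
  split_ifs <;> omega

theorem pairSwap_injective : Function.Injective (pairSwap n) :=
  Function.LeftInverse.injective pairSwap_pairSwap

theorem pairSwap_ne (p : Fin (2 * n)) : pairSwap n p ≠ p := by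
  intro h
  have := congrArg Fin.val h
  rw [pairSwap_val] at this
  split_ifs at this <;> omega

theorem pairSwap_lo (j : Fin n) : pairSwap n (lo n j) = hi n j := by
  apply Fin.ext
  simp [pairSwap_val, lo, hi]

theorem pairSwap_hi (j : Fin n) : pairSwap n (hi n j) = lo n j := by
  rw [← pairSwap_lo, pairSwap_pairSwap]

theorem pairSwap_lt_pairSwap {p q : Fin (2 * n)} (h : q ≠ p) (h' : q ≠ pairSwap n p) :
    pairSwap n p < pairSwap n q ↔ p < q := by
  have h1 : (q : ℕ) ≠ p := fun e => h (Fin.ext e)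
  have h2 : (q : ℕ) ≠ pairSwap n p := fun e => h' (Fin.ext e)
  rw [Fin.lt_def, Fin.lt_def]
  rw [pairSwap_val] at h2 ⊢
  rw [pairSwap_val]
  split_ifs at h2 ⊢ <;> omega

theorem mem_image_pairSwap {A : Finset (Fin (2 * n))} {p : Fin (2 * n)} :
    p ∈ A.image (pairSwap n) ↔ pairSwap n p ∈ A := by
  rw [← pairSwap_injective.mem_finset_image (s := A), pairSwap_pairSwap]

theorem image_pairSwap_image_pairSwap (A : Finset (Fin (2 * n))) :
    (A.image (pairSwap n)).image (pairSwap n) = A := by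
  ext p
  simp only [mem_image_pairSwap, pairSwap_pairSwap]

theorem compl_image_pairSwap (A : Finset (Fin (2 * n))) :
    (A.image (pairSwap n))ᶜ = Aᶜ.image (pairSwap n) := by
  ext p
  simp only [Finset.mem_compl, mem_image_pairSwap]

theorem card_image_pairSwap (A : Finset (Fin (2 * n))) : (A.image (pairSwap n)).card = A.card :=
  Finset.card_image_of_injective _ pairSwap_injective

theorem sum_lo_add_hi {M : Type*} [AddCommMonoid M] (f : Fin (2 * n) → M) :
    ∑ j : Fin n, (f (lo n j) + f (hi n j)) = ∑ p, f p := by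
  have hb : Function.Bijective (Sum.elim (lo n) (hi n)) := by
    constructor
    · rintro (a | a) (b | b) h <;> have h := congrArg Fin.val h <;>
        simp [lo, hi, Fin.val_inj] at h ⊢ <;> omega
    · intro p
      have hp := p.isLt
      rcases Nat.mod_two_eq_zero_or_one p with h | h
      · exact ⟨Sum.inl ⟨p / 2, by omega⟩, Fin.ext (by simp [lo]; omega)⟩
      · exact ⟨Sum.inr ⟨p / 2, by omega⟩, Fin.ext (by simp [hi]; omega)⟩
  rw [Finset.sum_add_distrib, ← hb.sum_comp f, Fintype.sum_sum_type]
  rfl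

theorem prod_swap_sign (p : Fin (2 * n)) (T : Finset (Fin (2 * n))) (hp : p ∉ T) :
    (∏ q ∈ T, (if p < q then (-1 : ℂ) else 1) *
      (if pairSwap n q < pairSwap n p then (-1 : ℂ) else 1)) =
      (-1) ^ T.card * if pairSwap n p ∈ T then -1 else 1 := by
  rw [← prod_ite_eq_one_neg_one]
  refine Finset.prod_congr rfl fun q hq => ?_
  have hne : q ≠ p := fun h => hp (h ▸ hq)
  by_cases h : q = pairSwap n p
  · subst h
    simp only [pairSwap_pairSwap, if_true]
    split_ifs <;> simp
  · rw [if_neg h]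
    have h1 := pairSwap_lt_pairSwap hne h
    have h2 : pairSwap n q ≠ pairSwap n p := pairSwap_injective.ne hne
    by_cases hlt : p < q
    · simp [hlt, (h1.2 hlt).not_gt]
    · have := lt_of_le_of_ne (not_lt.1 (mt h1.1 hlt)) h2
      simp [hlt, this]

/-- The number of generators in `S` whose partner is not in `S` has the parity of `S`. -/
theorem prod_unpaired (S : Finset (Fin (2 * n))) :
    (∏ p ∈ S, if pairSwap n p ∈ Sᶜ then (-1 : ℂ) else 1) = (-1) ^ S.card := by
  have h : (∏ p ∈ S, if pairSwap n p ∈ S then (-1 : ℂ) else 1) = 1 := by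
    rw [← Finset.prod_filter]
    refine Finset.prod_involution (fun p _ => pairSwap n p) ?_ ?_ ?_ ?_
    · intros; norm_num
    · intro p _ _; exact pairSwap_ne p
    · intro p hp; simpa [and_comm] using hp
    · intro p _; exact pairSwap_pairSwap p
  rw [← mul_one (∏ p ∈ S, _), ← h, ← Finset.prod_mul_distrib, ← Finset.prod_const]
  refine Finset.prod_congr rfl fun p _ => ?_
  by_cases hp : pairSwap n p ∈ S <;> simp [hp]

theorem msign_image_pairSwap_mul_msign (S : Finset (Fin (2 * n))) :
    (Gr.msign (S.image (pairSwap n)) (Sᶜ.image (pairSwap n)) : ℂ) * Gr.msign Sᶜ S = 1 := by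
  rw [Gr.msign_eq_prod, Gr.msign_eq_prod Sᶜ S, Finset.prod_comm (s := Sᶜ),
    Finset.prod_image pairSwap_injective.injOn]
  simp only [Finset.prod_image pairSwap_injective.injOn]
  rw [← Finset.prod_mul_distrib]
  have : ∀ p ∈ S, ((∏ q ∈ Sᶜ, if pairSwap n q < pairSwap n p then (-1 : ℂ) else 1) *
      ∏ q ∈ Sᶜ, if p < q then (-1 : ℂ) else 1) =
      (-1) ^ Sᶜ.card * if pairSwap n p ∈ Sᶜ then -1 else 1 := by
    intro p hp
    rw [← prod_swap_sign p Sᶜ (by simpa using hp), ← Finset.prod_mul_distrib]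
    exact Finset.prod_congr rfl fun _ _ => mul_comm _ _
  have hc : Even (Sᶜ.card * S.card + S.card) := by
    have h := Finset.card_compl_add_card S
    rw [Fintype.card_fin] at h
    have e : Sᶜ.card * S.card + S.card = (Sᶜ.card + 1) * S.card := by ring
    rw [e, Nat.even_mul]
    rcases Nat.even_or_odd S.card with h' | h'
    · exact Or.inr h'
    · left
      rw [Nat.even_iff]
      rw [Nat.odd_iff] at h'
      omega
  rw [Finset.prod_congr rfl this, Finset.prod_mul_distrib, prod_unpaired, Finset.prod_const,
    ← pow_mul, ← pow_add, hc.neg_one_pow]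

end Swap

section Kernel

variable {n : ℕ}

theorem xi_injective : Function.Injective (xi n) := Fin.castAdd_injective _ _

theorem yi_injective : Function.Injective (yi n) := Fin.natAdd_injective _ _

theorem xi_lt_yi (p q : Fin (2 * n)) : xi n p < yi n q := by
  have := p.isLt
  rw [Fin.lt_def]
  simp [xi, yi]
  omega

theorem xi_lt_xi {p q : Fin (2 * n)} : xi n p < xi n q ↔ p < q := Iff.rfl

theorem yi_lt_yi {p q : Fin (2 * n)} : yi n p < yi n q ↔ p < q := by
  simp [yi]

theorem xi_ne_yi (p q : Fin (2 * n)) : xi n p ≠ yi n q := (xi_lt_yi p q).ne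

/-- The set of generators of the mixed algebra consisting of the `x` generators indexed by `A`
and the `y` generators indexed by `B`. -/
def mixedSet (A B : Finset (Fin (2 * n))) : Finset (Fin (2 * n + 2 * n)) :=
  A.image (xi n) ∪ B.image (yi n)

@[simp] theorem xi_mem_mixedSet {A B : Finset (Fin (2 * n))} {p : Fin (2 * n)} :
    xi n p ∈ mixedSet A B ↔ p ∈ A := by
  simp [mixedSet, xi_injective.eq_iff, (xi_ne_yi _ _).symm]

@[simp] theorem yi_mem_mixedSet {A B : Finset (Fin (2 * n))} {p : Fin (2 * n)} :
    yi n p ∈ mixedSet A B ↔ p ∈ B := by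
  simp [mixedSet, yi_injective.eq_iff, xi_ne_yi]

theorem mixedSet_ext {s t : Finset (Fin (2 * n + 2 * n))} (hx : ∀ p, xi n p ∈ s ↔ xi n p ∈ t)
    (hy : ∀ p, yi n p ∈ s ↔ yi n p ∈ t) : s = t := by
  ext i
  exact Fin.addCases (motive := fun i => i ∈ s ↔ i ∈ t) hx hy i

theorem prod_mixedSet (A B : Finset (Fin (2 * n))) (f : Fin (2 * n + 2 * n) → ℂ) :
    ∏ i ∈ mixedSet A B, f i = (∏ p ∈ A, f (xi n p)) * ∏ p ∈ B, f (yi n p) := by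
  rw [mixedSet, Finset.prod_union, Finset.prod_image xi_injective.injOn,
    Finset.prod_image yi_injective.injOn]
  rw [Finset.disjoint_left]
  intro i hi hi'
  obtain ⟨p, -, rfl⟩ := Finset.mem_image.1 hi
  obtain ⟨q, -, h⟩ := Finset.mem_image.1 hi'
  exact xi_ne_yi p q h.symm

theorem mixedSet_sdiff_pair (A B : Finset (Fin (2 * n))) (p q : Fin (2 * n)) :
    mixedSet A B \ {xi n p, yi n q} = mixedSet (A.erase p) (B.erase q) := by
  apply mixedSet_ext <;> intro r <;>
    simp [xi_injective.eq_iff, yi_injective.eq_iff, xi_ne_yi, (xi_ne_yi _ _).symm, and_comm]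

theorem msign_mixedSet_pair (A : Finset (Fin (2 * n))) (p : Fin (2 * n)) (hp : p ∉ A) :
    (Gr.msign (mixedSet A (A.image (pairSwap n))) {xi n p, yi n (pairSwap n p)} : ℂ) =
      (-1) ^ A.card * if pairSwap n p ∈ A then -1 else 1 := by
  rw [Gr.msign_eq_prod, prod_mixedSet, Finset.prod_image pairSwap_injective.injOn,
    ← Finset.prod_mul_distrib, ← prod_ite_eq_one_neg_one]
  refine Finset.prod_congr rfl fun q hq => ?_
  have hne : q ≠ p := fun h => hp (h ▸ hq)
  rw [Finset.prod_pair (xi_ne_yi _ _), Finset.prod_pair (xi_ne_yi _ _)]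
  simp only [xi_lt_xi, yi_lt_yi, xi_lt_yi, (xi_lt_yi _ _).not_gt, if_true, if_false]
  by_cases h : q = pairSwap n p
  · subst h
    simp only [pairSwap_pairSwap, if_true]
    rcases lt_or_gt_of_ne hne with h | h <;> simp [h, h.not_gt]
  · simp only [h, pairSwap_lt_pairSwap hne h, if_false]
    split_ifs <;> simp

/-- The coefficient of the Fourier kernel on the monomial with `x` generators indexed by `A`
and `y` generators indexed by `A.image (pairSwap n)`. -/
noncomputable def kernelCoeff (c : ℂ) (A : Finset (Fin (2 * n))) : ℂ :=
  c ^ A.card * (-1) ^ (A.card.choose 2) *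
    ∏ j : Fin n, if hi n j ∈ A ∧ lo n j ∉ A then -1 else 1

/-- The sign of the generator `p` in the exponent of the Fourier kernel. -/
noncomputable def pairSign (p : Fin (2 * n)) : ℂ := if (p : ℕ) % 2 = 0 then 1 else -1

theorem pairSign_lo (j : Fin n) : pairSign (lo n j) = 1 := by simp [pairSign, lo]

theorem pairSign_hi (j : Fin n) : pairSign (hi n j) = -1 := by
  simp [pairSign, hi, Nat.add_mod]

theorem eq_lo_or_eq_hi (p : Fin (2 * n)) : ∃ j, p = lo n j ∨ p = hi n j := by
  have hp := p.isLt
  refine ⟨⟨p / 2, by omega⟩, ?_⟩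
  rcases Nat.mod_two_eq_zero_or_one p with h | h
  · exact Or.inl (Fin.ext (by simp [lo]; omega))
  · exact Or.inr (Fin.ext (by simp [hi]; omega))

theorem lo_inj {i j : Fin n} : lo n i = lo n j ↔ i = j := by
  simp [lo, Fin.ext_iff]

theorem hi_inj {i j : Fin n} : hi n i = hi n j ↔ i = j := by
  simp [hi, Fin.ext_iff]

theorem lo_ne_hi (i j : Fin n) : lo n i ≠ hi n j := by
  simp [lo, hi, Fin.ext_iff]
  omega

theorem kernelCoeff_eq_erase (c : ℂ) (A : Finset (Fin (2 * n))) (p : Fin (2 * n)) (hp : p ∈ A) :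
    c * (pairSign p * (((-1) ^ (A.erase p).card * if pairSwap n p ∈ A.erase p then -1 else 1) *
      kernelCoeff c (A.erase p))) = kernelCoeff c A := by
  have hc : A.card = (A.erase p).card + 1 := (Finset.card_erase_add_one hp).symm
  have hprod : pairSign p * (if pairSwap n p ∈ A.erase p then -1 else 1) *
      (∏ j : Fin n, if hi n j ∈ A.erase p ∧ lo n j ∉ A.erase p then (-1 : ℂ) else 1) =
      ∏ j : Fin n, if hi n j ∈ A ∧ lo n j ∉ A then -1 else 1 := by
    obtain ⟨i, hi'⟩ := eq_lo_or_eq_hi p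
    have hrest : (∏ j ∈ univ.erase i,
        if hi n j ∈ A.erase p ∧ lo n j ∉ A.erase p then (-1 : ℂ) else 1) = ∏ j ∈ univ.erase i, if hi n j ∈ A ∧ lo n j ∉ A then -1 else 1 := by
      refine Finset.prod_congr rfl fun j hj => ?_
      have hj := Finset.ne_of_mem_erase hj
      rcases hi' with rfl | rfl <;> simp [lo_inj, hi_inj, hj, lo_ne_hi, (lo_ne_hi _ _).symm]
    rw [← Finset.mul_prod_erase univ _ (Finset.mem_univ i), hrest, ← mul_assoc,
      ← Finset.mul_prod_erase univ (fun j => if hi n j ∈ A ∧ lo n j ∉ A then (-1 : ℂ) else 1)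
        (Finset.mem_univ i)]
    congr 1
    rcases hi' with rfl | rfl
    · by_cases h : hi n i ∈ A <;>
        simp [pairSign_lo, pairSwap_lo, (lo_ne_hi _ _).symm, hp, h]
    · by_cases h : lo n i ∈ A <;> simp [pairSign_hi, pairSwap_hi, lo_ne_hi, hp, h]
  unfold kernelCoeff
  rw [← hprod, hc, Nat.choose_succ_succ' _ 1, Nat.choose_one_right]
  ring

theorem kernel_exponent_eq (n : ℕ) :
    (∑ j : Fin n, (Gr.mul (Gr.gen (xi n (lo n j))) (Gr.gen (yi n (hi n j))) -
      Gr.mul (Gr.gen (xi n (hi n j))) (Gr.gen (yi n (lo n j)))) : Gr ℂ (2 * n + 2 * n)) =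
      ∑ p, pairSign p • Pi.single {xi n p, yi n (pairSwap n p)} 1 := by
  rw [← sum_lo_add_hi]
  refine Finset.sum_congr rfl fun j _ => ?_
  rw [Gr.gen_mul_gen (xi_lt_yi _ _), Gr.gen_mul_gen (xi_lt_yi _ _), pairSign_lo, pairSign_hi,
    pairSwap_lo, pairSwap_hi, one_smul, neg_one_smul, sub_eq_add_neg]

theorem pow_kernel_exponent (c : ℂ) (k : ℕ) (A B : Finset (Fin (2 * n))) :
    Gr.pow (c • ∑ p, pairSign p • Pi.single {xi n p, yi n (pairSwap n p)} 1 :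
      Gr ℂ (2 * n + 2 * n)) k (mixedSet A B) =
      if B = A.image (pairSwap n) ∧ A.card = k then k.factorial * kernelCoeff c A else 0 := by
  induction k generalizing A B with
  | zero =>
    have h : mixedSet A B = ∅ ↔ B = A.image (pairSwap n) ∧ A.card = 0 := by
      simp only [mixedSet, Finset.union_eq_empty, Finset.image_eq_empty, Finset.card_eq_zero]
      constructor
      · rintro ⟨rfl, rfl⟩; simp
      · rintro ⟨rfl, rfl⟩; simp
    simp only [Gr.pow, Gr.one, h]
    split_ifs with h
    · obtain rfl := Finset.card_eq_zero.1 h.2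
      simp [kernelCoeff]
    · rfl
  | succ k ih =>
    have hterm : ∀ p, c * (pairSign p * Gr.mul (Gr.pow
          (c • ∑ p, pairSign p • Pi.single {xi n p, yi n (pairSwap n p)} 1 :
            Gr ℂ (2 * n + 2 * n)) k) (Pi.single {xi n p, yi n (pairSwap n p)} 1) (mixedSet A B)) =
        if p ∈ A then (if B = A.image (pairSwap n) ∧ A.card = k + 1 then
          k.factorial * kernelCoeff c A else 0) else 0 := by
      intro p
      rw [Gr.mul_single, mixedSet_sdiff_pair, ih]
      have hsub : ({xi n p, yi n (pairSwap n p)} : Finset _) ⊆ mixedSet A B ↔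
          p ∈ A ∧ pairSwap n p ∈ B := by
        simp [Finset.insert_subset_iff]
      simp only [hsub]
      by_cases hp : p ∈ A
      · have hi1 : (A.erase p).image (pairSwap n) = (A.image (pairSwap n)).erase (pairSwap n p) :=
          Finset.image_erase pairSwap_injective _ _
        by_cases hB : B = A.image (pairSwap n)
        · subst hB
          have hmem : pairSwap n p ∈ A.image (pairSwap n) := Finset.mem_image_of_mem _ hp
          rw [← hi1, msign_mixedSet_pair _ _ (Finset.notMem_erase p A),
            ← kernelCoeff_eq_erase c A p hp]
          have hcard : (A.erase p).card = k ↔ A.card = k + 1 := by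
            rw [← Finset.card_erase_add_one hp]; omega
          simp only [hp, hmem, and_self, if_true, true_and, hcard]
          split_ifs <;> ring
        · have : ¬ (pairSwap n p ∈ B ∧ B.erase (pairSwap n p) = (A.erase p).image (pairSwap n)) := by
            rintro ⟨h1, h2⟩
            apply hB
            rw [← Finset.insert_erase h1, h2, hi1,
              Finset.insert_erase (Finset.mem_image_of_mem _ hp)]
          simp only [hp, hB, true_and, false_and, if_true, if_false]
          split_ifs with h1 h2
          · exact absurd ⟨h1, h2.1⟩ this
          all_goals simp
      · simp [hp]
    rw [Gr.pow, Gr.mul_smul_right, Gr.mul_sum_right]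
    simp only [Gr.mul_smul_right, Pi.smul_apply, Finset.sum_apply, smul_eq_mul, Finset.mul_sum,
      hterm]
    rw [Finset.sum_ite_mem, Finset.univ_inter, Finset.sum_const]
    split_ifs with h
    · rw [h.2, nsmul_eq_mul, Nat.factorial_succ]
      push_cast
      ring
    · simp

theorem fermK_apply (σ : ℂ) (A B : Finset (Fin (2 * n))) :
    fermK n σ (mixedSet A B) =
      if B = A.image (pairSwap n) then kernelCoeff (-σ * (Complex.I / 2)) A else 0 := by
  have hA : A.card ∈ Finset.range (2 * n + 2 * n + 1) := by
    have := Finset.card_le_univ A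
    rw [Fintype.card_fin] at this
    rw [Finset.mem_range]
    omega
  simp only [fermK, Gr.gexp, kernel_exponent_eq, Finset.sum_apply, Pi.smul_apply, smul_eq_mul,
    pow_kernel_exponent]
  rw [Finset.sum_eq_single_of_mem _ hA]
  · by_cases h : B = A.image (pairSwap n)
    · simp [h, Nat.factorial_ne_zero]
    · simp [h]
  · intro k _ hk
    simp [hk.symm]

theorem embX_eq_sum (g : Gr ℂ (2 * n)) :
    embX n g = ∑ A, g A • (Pi.single (A.image (xi n)) 1 : Gr ℂ (2 * n + 2 * n)) := by
  funext s
  simp [embX, Finset.sum_apply, Pi.single_apply]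

theorem berezinX_apply (F : Gr ℂ (2 * n + 2 * n)) (S : Finset (Fin (2 * n))) :
    berezinX n F (S.image (yi n)) = ((Real.pi : ℂ) ^ n)⁻¹ * F (mixedSet univ S) := by
  rw [berezinX, Pi.smul_apply, smul_eq_mul, Gr.derivList_apply]
  · congr 2
  · rw [List.pairwise_map]
    exact (List.pairwise_lt_finRange (2 * n)).imp xi_lt_xi.2
  · intro i hi j hj
    obtain ⟨p, -, rfl⟩ := List.mem_map.1 hi
    obtain ⟨q, -, rfl⟩ := Finset.mem_image.1 hj
    exact xi_lt_yi p q

theorem msign_mixedSet_image_xi (A B S : Finset (Fin (2 * n))) :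
    (Gr.msign (mixedSet A S) (B.image (xi n)) : ℂ) =
      Gr.msign A B * (-1) ^ (S.card * B.card) := by
  rw [Gr.msign_eq_prod, Gr.msign_eq_prod, prod_mixedSet]
  simp only [Finset.prod_image xi_injective.injOn, xi_lt_xi, xi_lt_yi, if_true,
    Finset.prod_const, ← pow_mul, mul_comm]

theorem fermFT_apply (σ : ℂ) (g : Gr ℂ (2 * n)) (S : Finset (Fin (2 * n))) :
    fermFT n σ g S = 2 ^ n * (Gr.msign (S.image (pairSwap n)) (Sᶜ.image (pairSwap n)) *
      (-1) ^ (S.card * Sᶜ.card)) * kernelCoeff (-σ * (Complex.I / 2)) (S.image (pairSwap n)) *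
      g (Sᶜ.image (pairSwap n)) := by
  have hpi : (Real.pi : ℂ) ≠ 0 := Complex.ofReal_ne_zero.2 Real.pi_ne_zero
  have hterm : ∀ A : Finset (Fin (2 * n)),
      Gr.mul (fermK n σ) (Pi.single (A.image (xi n)) 1) (mixedSet univ S) =
        if S = Aᶜ.image (pairSwap n) then (Gr.msign Aᶜ A * (-1) ^ (S.card * A.card)) *
          kernelCoeff (-σ * (Complex.I / 2)) Aᶜ else 0 := by
    intro A
    have hsub : A.image (xi n) ⊆ mixedSet univ S := by
      intro i hi
      obtain ⟨p, -, rfl⟩ := Finset.mem_image.1 hi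
      simp
    have hd : mixedSet univ S \ A.image (xi n) = mixedSet Aᶜ S := by
      apply mixedSet_ext <;> intro p <;> simp [xi_injective.eq_iff, xi_ne_yi]
    rw [Gr.mul_single, if_pos hsub, hd, fermK_apply, msign_mixedSet_image_xi, mul_ite, mul_zero]
  rw [fermFT, berezinX_apply, embX_eq_sum, Gr.mul_sum_right]
  simp only [Gr.mul_smul_right, Finset.sum_apply, Pi.smul_apply, smul_eq_mul, hterm]
  rw [Finset.sum_eq_single_of_mem (Sᶜ.image (pairSwap n)) (Finset.mem_univ _)]
  · rw [← compl_image_pairSwap, compl_compl, if_pos (image_pairSwap_image_pairSwap S).symm,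
      compl_image_pairSwap, card_image_pairSwap]
    push_cast
    rw [mul_pow]
    field_simp
  · intro A _ hA
    rw [if_neg, mul_zero]
    rintro rfl
    rw [← compl_image_pairSwap, image_pairSwap_image_pairSwap, compl_compl] at hA
    exact hA rfl

theorem kernelCoeff_mul_kernelCoeff_compl (c : ℂ) (hc : c ^ 2 = -1 / 4)
    (S : Finset (Fin (2 * n))) :
    kernelCoeff c (S.image (pairSwap n)) * kernelCoeff (-c) Sᶜ = (1 / 4) ^ n := by
  have hprod : (∏ j : Fin n, if hi n j ∈ S.image (pairSwap n) ∧ lo n j ∉ S.image (pairSwap n)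
      then (-1 : ℂ) else 1) * (∏ j : Fin n, if hi n j ∈ Sᶜ ∧ lo n j ∉ Sᶜ then (-1 : ℂ) else 1)
      = 1 := by
    rw [← Finset.prod_mul_distrib]
    refine Finset.prod_eq_one fun j _ => ?_
    simp only [mem_image_pairSwap, pairSwap_hi, pairSwap_lo, Finset.mem_compl, not_not]
    by_cases h1 : hi n j ∈ S <;> by_cases h2 : lo n j ∈ S <;> simp [h1, h2]
  have hcard := Finset.card_compl_add_card S
  rw [Fintype.card_fin] at hcard
  have hchoose : ∀ a b : ℕ, b + a = 2 * n →
      ((-1 : ℂ) ^ a.choose 2 * (-1) ^ b.choose 2) * (-1) ^ b = (-1) ^ n := by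
    intro a b hab
    have h : a.choose 2 + b.choose 2 + b + n + a * b = 2 * (n * n) + b := by
      have hab' : (b : ℚ) + a = 2 * n := by exact_mod_cast hab
      rw [← Nat.cast_inj (R := ℚ)]
      push_cast [Nat.cast_choose_two]
      linear_combination ((a + b : ℚ) / 2 - 1 / 2 + n) * hab'
    have hpar : Even (a * b) ↔ Even b := by
      rw [Nat.even_mul]
      simp only [Nat.even_iff]
      omega
    rw [← pow_add, ← pow_add]
    refine neg_one_pow_congr ?_
    have h' := congrArg Even h
    simp only [Nat.even_add, Nat.even_mul, even_two, true_or, true_iff, eq_iff_iff] at h' hpar ⊢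
    tauto
  unfold kernelCoeff
  rw [card_image_pairSwap]
  have hpow : c ^ S.card * c ^ Sᶜ.card * (-1) ^ n = (1 / 4) ^ n := by
    rw [← pow_add, add_comm, hcard, pow_mul, hc, ← mul_pow]
    norm_num
  rw [← hpow, ← hchoose _ _ hcard, neg_pow c Sᶜ.card]
  linear_combination (c ^ S.card * c ^ Sᶜ.card * ((-1 : ℂ) ^ S.card.choose 2 *
    (-1) ^ Sᶜ.card.choose 2 * (-1) ^ Sᶜ.card)) * hprod

end Kernel

theorem fermFT_fermFT_neg (n : ℕ) (σ : ℂ) (hσ : σ = 1 ∨ σ = -1) (g : Gr ℂ (2 * n)) :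
    fermFT n σ (fermFT n (-σ) g) = g := by
  funext S
  have hc : (-σ * (Complex.I / 2)) ^ 2 = -1 / 4 := by
    rcases hσ with rfl | rfl <;> ring_nf <;> rw [Complex.I_sq] <;> norm_num
  have hk := kernelCoeff_mul_kernelCoeff_compl _ hc S
  have hm := msign_image_pairSwap_mul_msign S
  have hs : ((-1 : ℂ) ^ (S.card * Sᶜ.card)) * (-1) ^ (Sᶜ.card * S.card) = 1 := by
    rw [mul_comm Sᶜ.card, ← mul_pow]
    norm_num
  have h4 : (2 : ℂ) ^ n * 2 ^ n * (1 / 4) ^ n = 1 := by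
    rw [← mul_pow, ← mul_pow]
    norm_num
  rw [fermFT_apply, fermFT_apply]
  rw [← compl_image_pairSwap, compl_compl, image_pairSwap_image_pairSwap, compl_image_pairSwap,
    image_pairSwap_image_pairSwap, card_image_pairSwap, card_image_pairSwap]
  have hneg : - -σ * (Complex.I / 2) = -(-σ * (Complex.I / 2)) := by ring
  rw [hneg]
  rw [← hk] at h4
  calc _ = 2 ^ n * 2 ^ n * (kernelCoeff (-σ * (Complex.I / 2)) (S.image (pairSwap n)) *
        kernelCoeff (-(-σ * (Complex.I / 2))) Sᶜ) *
        (Gr.msign (S.image (pairSwap n)) (Sᶜ.image (pairSwap n)) * Gr.msign Sᶜ S) *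
        ((-1) ^ (S.card * Sᶜ.card) * (-1) ^ (Sᶜ.card * S.card)) * g S := by ring
    _ = g S := by rw [h4, hm, hs, one_mul, one_mul, one_mul]

/-- Inversion theorem for the fermionic Fourier transform:
`F^+_{0|2n} ∘ F^-_{0|2n} = id` and `F^-_{0|2n} ∘ F^+_{0|2n} = id` on `Λ_{2n}`
(for `σ = ±1`, the transform with the opposite sign is `fermFT n (-σ)`); consequently
`F^±_{0|2n}` is a (clearly linear) isomorphism of `Λ_{2n}`. -/
theorem fermFT_inversion (n : ℕ) (σ : ℂ) (hσ : σ = 1 ∨ σ = -1) :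
    (∀ g : Gr ℂ (2 * n), fermFT n σ (fermFT n (-σ) g) = g) ∧
    (∀ g : Gr ℂ (2 * n), fermFT n (-σ) (fermFT n σ g) = g) ∧
    Function.Bijective (fermFT n σ) := by
  have h : ∀ g, fermFT n (-σ) (fermFT n σ g) = g := fun g => by
    have := fermFT_fermFT_neg n (-σ) (by rcases hσ with rfl | rfl <;> simp) g
    rwa [neg_neg] at this
  exact ⟨fermFT_fermFT_neg n σ hσ, h, Function.LeftInverse.injective h,
    Function.RightInverse.surjective (fermFT_fermFT_neg n σ hσ)⟩
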